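/- The energy Hilbert space on ℤ has no monopoles: for every x₀ ∈ ℤ, there exist no function w : ℤ → ℂ with finite energy ∑_{n∈ℤ} |w(n) − w(n+1)|² < ∞ and no constant κ ∈ ℂ such that 2·w(n) − w(n+1) − w(n−1) = δ_{x₀}(n) + κ for all n ∈ ℤ, where δ_{x₀}(n) = 1 if n = x₀ and 0 otherwise. -/

import Mathlib

open Complex

open Filter Topology in
/-- A function on `ℤ` that vanishes at infinity does not have difference `δ_{x₀} + κ`. -/
theorem not_forall_sub_eq_delta_add_const {d : ℤ → ℂ} (hd : Tendsto d cofinite (𝓝 0)) (x₀ : ℤ)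
    (κ : ℂ) : ¬ ∀ n, d n - d (n - 1) = (if n = x₀ then (1 : ℂ) else 0) + κ := by
  intro h
  have along {f : ℕ → ℤ} (hf : Function.Injective f) :
      Tendsto (fun k => d (f k)) atTop (𝓝 0) := by
    simpa [Function.comp_def, Nat.cofinite_eq_atTop] using hd.comp hf.tendsto_cofinite
  have h_right : Tendsto (fun k : ℕ => d (x₀ + k)) atTop (𝓝 0) := along fun a b hab => by grind
  have h_left : Tendsto (fun k : ℕ => d (x₀ - 1 - k)) atTop (𝓝 0) := along fun a b hab => by grind
  have hκ : κ = 0 := by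
    have h_diff := ((tendsto_add_atTop_iff_nat 1).2 h_right).sub h_right
    rw [sub_zero] at h_diff
    refine tendsto_nhds_unique (tendsto_const_nhds.congr fun k => ?_) h_diff
    have hk := h (x₀ + (k + 1 : ℕ))
    rw [if_neg (by omega), show x₀ + ((k + 1 : ℕ) : ℤ) - 1 = x₀ + k by omega, zero_add] at hk
    exact hk.symm
  have const_right (k : ℕ) : d (x₀ + k) = d x₀ := by
    induction k with
    | zero => simp
    | succ k ih =>
      have hk := h (x₀ + (k + 1 : ℕ))
      rw [if_neg (by omega), show x₀ + ((k + 1 : ℕ) : ℤ) - 1 = x₀ + k by omega, hκ, add_zero] at hk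
      exact (sub_eq_zero.1 hk).trans ih
  have const_left (k : ℕ) : d (x₀ - 1 - k) = d (x₀ - 1) := by
    induction k with
    | zero => simp
    | succ k ih =>
      have hk := h (x₀ - 1 - k)
      rw [if_neg (by omega), show x₀ - 1 - (k : ℤ) - 1 = x₀ - 1 - (k + 1 : ℕ) by omega, hκ,
        add_zero] at hk
      exact (sub_eq_zero.1 hk).symm.trans ih
  have h₁ : d x₀ = 0 :=
    tendsto_nhds_unique (tendsto_const_nhds.congr fun k => (const_right k).symm) h_right
  have h₂ : d (x₀ - 1) = 0 :=
    tendsto_nhds_unique (tendsto_const_nhds.congr fun k => (const_left k).symm) h_left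
  simpa [h₁, h₂, hκ] using h x₀

/-- **(Lemma 2.5, no monopoles.)** The energy Hilbert space on `ℤ` has no monopoles: for every
`x₀ ∈ ℤ` there is no finite-energy function `w : ℤ → ℂ` and no constant `κ ∈ ℂ` with
`2 w n - w (n+1) - w (n-1) = δ_{x₀} n + κ` for all `n`. -/
theorem stmt_3 (x₀ : ℤ) :
    ¬ ∃ (w : ℤ → ℂ) (κ : ℂ),
      (Summable fun n : ℤ => ‖w n - w (n + 1)‖ ^ 2) ∧
      (∀ n : ℤ, 2 * w n - w (n + 1) - w (n - 1) = (if n = x₀ then (1 : ℂ) else 0) + κ) := by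
  rintro ⟨w, κ, hw, h⟩
  have hd : Filter.Tendsto (fun n => w n - w (n + 1)) Filter.cofinite (nhds 0) := by
    rw [tendsto_zero_iff_norm_tendsto_zero]
    simpa using hw.tendsto_cofinite_zero.sqrt
  refine not_forall_sub_eq_delta_add_const hd x₀ κ fun n => ?_
  rw [← h n, sub_add_cancel]
  ring
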